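/- Let a = (a_1, a_2, a_1, a_2, …) be the 2-periodic sequence with a_1 < 1/3 and a_2 > 1/3. If a_1 ≤ 1/35 and a_2 ≤ (−a_1 − 5 + √(a_1² + 34a_1 + 33))/(2 − 2a_1), then C(a) − C(a) is a Cantorval. -/

import Mathlib

open Pointwise MeasureTheory

namespace CCS

/-- `dSeq a n` is the common length `d_n = ∏_{i=1}^n (1 - a_i)/2` of the intervals of the
`n`-th step of the construction of the central Cantor set `C(a)` (`d_0 = 1`).
The sequence `a` is indexed from `1`; the value `a 0` is irrelevant. -/
noncomputable def dSeq (a : ℕ → ℝ) (n : ℕ) : ℝ :=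
  ∏ i ∈ Finset.Icc 1 n, ((1 - a i) / 2)

/-- Left endpoint of the interval `I_t`, `t ∈ {0,1}^n` (coded as a list, the paper's
`t_j` being `t.getD (j-1) 0`): `l(I_t) = ∑_{j=1}^n t_j (d_{j-1} - d_j)`. -/
noncomputable def Il (a : ℕ → ℝ) (t : List ℕ) : ℝ :=
  ∑ j ∈ Finset.range t.length, (t.getD j 0 : ℝ) * (dSeq a j - dSeq a (j + 1))

/-- The `n`-th step `C_n(a)` of the construction of the central Cantor set:
the union of the intervals `I_t = [l(I_t), l(I_t) + d_n]` over `t ∈ {0,1}^n`. -/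
noncomputable def cantorStep (a : ℕ → ℝ) (n : ℕ) : Set ℝ :=
  ⋃ t ∈ {t : List ℕ | t.length = n ∧ ∀ j ∈ t, j ≤ 1},
    Set.Icc (Il a t) (Il a t + dSeq a n)

/-- The central Cantor set `C(a) = ⋂ₙ C_n(a)`. -/
noncomputable def cantorSet (a : ℕ → ℝ) : Set ℝ := ⋂ n, cantorStep a n

/-- Left endpoint of the interval `J_s = I_t - I_p`, for `s ∈ {0,1,2}^n`:
`l(J_s) = -1 + ∑_{j=1}^n s_j (d_{j-1} - d_j)`. -/
noncomputable def Jl (a : ℕ → ℝ) (s : List ℕ) : ℝ :=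
  -1 + ∑ j ∈ Finset.range s.length, (s.getD j 0 : ℝ) * (dSeq a j - dSeq a (j + 1))

/-- Right endpoint of `J_s`: `r(J_s) = l(J_s) + 2 d_n`. -/
noncomputable def Jr (a : ℕ → ℝ) (s : List ℕ) : ℝ :=
  Jl a s + 2 * dSeq a s.length

/-- The interval `J_s`. -/
noncomputable def Jset (a : ℕ → ℝ) (s : List ℕ) : Set ℝ := Set.Icc (Jl a s) (Jr a s)

/-- Left endpoint of the gap `G^i_s` (`i = 0`: left gap, `i = 1`: right gap) of `J_s`. -/
noncomputable def Gl (a : ℕ → ℝ) (i : ℕ) (s : List ℕ) : ℝ :=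
  Jl a s + (i : ℝ) * (dSeq a s.length - dSeq a (s.length + 1)) + 2 * dSeq a (s.length + 1)

/-- Right endpoint of the gap `G^i_s`. -/
noncomputable def Gr (a : ℕ → ℝ) (i : ℕ) (s : List ℕ) : ℝ :=
  Jl a s + ((i : ℝ) + 1) * (dSeq a s.length - dSeq a (s.length + 1))

/-- The gap `G^i_s ⊆ J_s`, an open interval. -/
noncomputable def Gset (a : ℕ → ℝ) (i : ℕ) (s : List ℕ) : Set ℝ :=
  Set.Ioo (Gl a i s) (Gr a i s)

/-- `N(0,s) = max {j : s_j > 0}`, `N(1,s) = max {j : s_j < 2}` (1-based, `max ∅ = 0`). -/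
noncomputable def Nidx (i : ℕ) (s : List ℕ) : ℕ :=
  sSup {j | 1 ≤ j ∧ j ≤ s.length ∧
    (if i = 0 then 0 < s.getD (j - 1) 0 else s.getD (j - 1) 0 < 2)}

/-- The family `𝒢^{i0}_{s0}(n)` of (indices of) gaps of rank `n`, for
`s0 ∈ {0,1,2}^{k_m - 1}`; a gap `G^i_s` is coded by the pair `(i, s)`.
`𝒢^{i0}_{s0}(m) = {G^{i0}_{s0}}` and for `n > m`,
`𝒢^{i0}_{s0}(n)` consists of the gap `Ḡ^{i0}_{s0}(n)` together with the gaps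
`Ḡ^1_{t^j}(n)`, `Ḡ^0_{t^(j+1)}(n)` for all `G^j_t ∈ 𝒢^{i0}_{s0}(l)`, `m ≤ l < n`. -/
def gapFamily (k : ℕ → ℕ) (i0 : ℕ) (s0 : List ℕ) (m : ℕ) (n : ℕ) : Set (ℕ × List ℕ) :=
  if n ≤ m then {(i0, s0)}
  else
    {(i0, s0 ++ List.replicate (k n - k m) (2 * i0))} ∪
      ⋃ (l : ℕ) (_ : m ≤ l) (hl : l < n),
        ⋃ p ∈ gapFamily k i0 s0 m l,
          ({(1, p.2 ++ p.1 :: List.replicate (k n - k l - 1) 2),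
            (0, p.2 ++ (p.1 + 1) :: List.replicate (k n - k l - 1) 0)} : Set (ℕ × List ℕ))
termination_by n
decreasing_by exact hl

/-- The family `𝒢^{i0}_{s0} = ⋃_{n ≥ m} 𝒢^{i0}_{s0}(n)`. -/
def gapFamilyAll (k : ℕ → ℕ) (i0 : ℕ) (s0 : List ℕ) (m : ℕ) : Set (ℕ × List ℕ) :=
  ⋃ (n : ℕ) (_ : m ≤ n), gapFamily k i0 s0 m n

/-- The family `𝒢_t := 𝒢^0_{t ++ 0^{(k_m - |t| - 1)}} ∪ 𝒢^1_{t ++ 2^{(k_m - |t| - 1)}}`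
for `t ∈ {0,1,2}^k` with `k_{m-1} ≤ k < k_m`. -/
def gapFamilyT (k : ℕ → ℕ) (m : ℕ) (t : List ℕ) : Set (ℕ × List ℕ) :=
  gapFamilyAll k 0 (t ++ List.replicate (k m - t.length - 1) 0) m ∪
    gapFamilyAll k 1 (t ++ List.replicate (k m - t.length - 1) 2) m

/-- The union `⋃ 𝒢` of a family of (indices of) gaps, as a subset of `ℝ`. -/
noncomputable def gapUnion (a : ℕ → ℝ) (G : Set (ℕ × List ℕ)) : Set ℝ :=
  ⋃ p ∈ G, Gset a p.1 p.2

/-- `padSeq k c s m n` is the index of the gap `G^i(s,n)` (for `c = 2i`):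
`s ++ c^{(k_m - |s| - 1)} ++ 1 ++ c^{(k_{m+1} - k_m - 1)} ++ 1 ++ ⋯ ++ 1 ++ c^{(k_n - k_{n-1} - 1)}`. -/
def padSeq (k : ℕ → ℕ) (c : ℕ) (s : List ℕ) (m : ℕ) : ℕ → List ℕ
  | 0 => s ++ List.replicate (k m - s.length - 1) c
  | n + 1 =>
    if n + 1 ≤ m then s ++ List.replicate (k m - s.length - 1) c
    else padSeq k c s m n ++ 1 :: List.replicate (k (n + 1) - k n - 1) c

/-- `δ_n := min {3d_i - d_{i-1} : k_{n-1} + 1 ≤ i ≤ k_n - 1}` (as an element of `EReal`,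
so that `min ∅ = ⊤ = ∞`). -/
noncomputable def deltaMin (a : ℕ → ℝ) (k : ℕ → ℕ) (n : ℕ) : EReal :=
  sInf ((fun i => ((3 * dSeq a i - dSeq a (i - 1) : ℝ) : EReal)) ''
    (Set.Icc (k (n - 1) + 1) (k n - 1)))

/-- `Δ_n := max {3d_i - d_{i-1} : k_{n-1} + 1 ≤ i ≤ k_n - 1}` (`max ∅ = ⊥ = -∞`). -/
noncomputable def deltaMax (a : ℕ → ℝ) (k : ℕ → ℕ) (n : ℕ) : EReal :=
  sSup ((fun i => ((3 * dSeq a i - dSeq a (i - 1) : ℝ) : EReal)) ''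
    (Set.Icc (k (n - 1) + 1) (k n - 1)))

/-- `m_n := min { δ_n - (d_{k_n - 1} - d_{k_n}), 4 d_{k_n} - Δ_n }`. -/
noncomputable def mSeq (a : ℕ → ℝ) (k : ℕ → ℕ) (n : ℕ) : EReal :=
  min (deltaMin a k n - ((dSeq a (k n - 1) - dSeq a (k n) : ℝ) : EReal))
    (((4 * dSeq a (k n) : ℝ) : EReal) - deltaMax a k n)

/-- `∑_{i=n+1}^∞ (d_{k_i - 1} - d_{k_i})`. -/
noncomputable def tailSum (a : ℕ → ℝ) (k : ℕ → ℕ) (n : ℕ) : ℝ :=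
  ∑' i : ℕ, (dSeq a (k (n + 1 + i) - 1) - dSeq a (k (n + 1 + i)))

/-- Condition `(*)`: `m_n ≥ 2 ∑_{i=n+1}^∞ (d_{k_i - 1} - d_{k_i})` for every `n ∈ ℕ`. -/
def condStar (a : ℕ → ℝ) (k : ℕ → ℕ) : Prop :=
  ∀ n : ℕ, 1 ≤ n → ((2 * tailSum a k n : ℝ) : EReal) ≤ mSeq a k n

/-- `(k_n)_{n ≥ 1}` is the increasing enumeration of all indices greater than `k 0 = k₀`
at which `a` exceeds `1/3`. -/
def IsGapEnum (a : ℕ → ℝ) (k : ℕ → ℕ) : Prop :=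
  StrictMono k ∧ (∀ n, 1 ≤ n → k 0 < k n ∧ 1 / 3 < a (k n)) ∧
    (∀ j, k 0 < j → 1 / 3 < a j → ∃ n, 1 ≤ n ∧ k n = j)

/-- `G` is a gap of `E`: a bounded connected component of `ℝ ∖ E`. -/
def IsGapOf (E G : Set ℝ) : Prop :=
  (∃ x ∉ E, G = connectedComponentIn Eᶜ x) ∧ Bornology.IsBounded G

/-- `C` is a proper (nontrivial) connected component of `E`. -/
def IsProperComponentOf (E C : Set ℝ) : Prop :=
  (∃ x ∈ E, C = connectedComponentIn E x) ∧ C.Nontrivial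

/-- `E` is a Cantorval: a perfect set with infinitely many gaps such that both endpoints
of every gap are accumulated both by gaps and by proper components of `E`. -/
def IsCantorval (E : Set ℝ) : Prop :=
  Perfect E ∧ {G : Set ℝ | IsGapOf E G}.Infinite ∧
    ∀ G, IsGapOf E G → ∀ p, p = sInf G ∨ p = sSup G →
      (∀ ε > 0, ∃ G', IsGapOf E G' ∧ G' ≠ G ∧ G' ⊆ Set.Ioo (p - ε) (p + ε)) ∧
      (∀ ε > 0, ∃ C, IsProperComponentOf E C ∧ C ⊆ Set.Ioo (p - ε) (p + ε))

/-- `J_s` and `J_u` (of length `k_m - 1`) are associated: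
`N := N(0,s) = N(1,u) ∈ {k_{m-1}+1, …, k_m - 1}`, `s|(N-1) = u|(N-1)`, `u_N = s_N - 1`.
Then `J_u` is the interval covering `𝒢^0_s` and `J_s` is the interval covering `𝒢^1_u`. -/
def Associated (k : ℕ → ℕ) (m : ℕ) (s u : List ℕ) : Prop :=
  s.length = k m - 1 ∧ u.length = k m - 1 ∧
    Nidx 0 s = Nidx 1 u ∧
    k (m - 1) + 1 ≤ Nidx 0 s ∧ Nidx 0 s ≤ k m - 1 ∧
    s.take (Nidx 0 s - 1) = u.take (Nidx 0 s - 1) ∧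
    u.getD (Nidx 0 s - 1) 0 = s.getD (Nidx 0 s - 1) 0 - 1

/-- `G^i_g ⊂_* J_v`: the gap `G^i_g` is covered by the interval `J_v`, i.e. `G^i_g`
belongs to a family `𝒢^0_w` (resp. `𝒢^1_w`) such that `J_v` is the interval covering it. -/
def CoversGap (k : ℕ → ℕ) (i : ℕ) (g : List ℕ) (v : List ℕ) : Prop :=
  ∃ m w, 1 ≤ m ∧
    ((Associated k m w v ∧ (i, g) ∈ gapFamilyAll k 0 w m) ∨
      (Associated k m v w ∧ (i, g) ∈ gapFamilyAll k 1 w m))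

/-- The achievement set `E(x) = {∑_{j ∈ A} x_j : A ⊆ ℕ}` of a series (indexed from `1`). -/
def achievementSet (x : ℕ → ℝ) : Set ℝ :=
  {y | ∃ A : Set ℕ, A ⊆ {n | 1 ≤ n} ∧ HasSum (A.indicator x) y}

lemma gap_of_Ioo {F : Set ℝ} {l r x : ℝ} (hl : l ∈ F) (hr : r ∈ F)
    (hd : ∀ y ∈ F, ¬ (l < y ∧ y < r)) (hx : x ∈ Set.Ioo l r) :
    connectedComponentIn Fᶜ x = Set.Ioo l r := by
  have hsub : Set.Ioo l r ⊆ Fᶜ := fun y hy hyF => hd y hyF hy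
  apply Set.Subset.antisymm
  · intro z hz
    have hxF : x ∈ Fᶜ := hsub hx
    have hpre : IsPreconnected (connectedComponentIn Fᶜ x) := isPreconnected_connectedComponentIn
    have hxm : x ∈ connectedComponentIn Fᶜ x := mem_connectedComponentIn hxF
    have hoc := hpre.ordConnected
    constructor
    · by_contra h
      push Not at h
      exact connectedComponentIn_subset _ _ (hoc.out hz hxm ⟨h, hx.1.le⟩) hl
    · by_contra h
      push Not at h
      exact connectedComponentIn_subset _ _ (hoc.out hxm hz ⟨hx.2.le, h⟩) hr
  · exact isPreconnected_Ioo.subset_connectedComponentIn hx hsub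

lemma isGap_of_Ioo {F : Set ℝ} {l r : ℝ} (hlr : l < r) (hl : l ∈ F) (hr : r ∈ F)
    (hd : ∀ y ∈ F, ¬ (l < y ∧ y < r)) : IsGapOf F (Set.Ioo l r) := by
  have hx : (l + r) / 2 ∈ Set.Ioo l r := ⟨by linarith, by linarith⟩
  exact ⟨⟨(l + r) / 2, fun h => hd _ h hx, (gap_of_Ioo hl hr hd hx).symm⟩, Metric.isBounded_Ioo l r⟩

lemma Ioo_of_isGap {F G : Set ℝ} (hcl : IsClosed F) (hG : IsGapOf F G) :
    ∃ l r, l < r ∧ l ∈ F ∧ r ∈ F ∧ (∀ y ∈ F, ¬ (l < y ∧ y < r)) ∧ G = Set.Ioo l r := by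
  obtain ⟨⟨x, hx, rfl⟩, hb⟩ := hG
  have hA : (F ∩ Set.Iic x).Nonempty := by
    by_contra h
    rw [Set.not_nonempty_iff_eq_empty] at h
    have hs : Set.Iic x ⊆ connectedComponentIn Fᶜ x :=
      isPreconnected_Iic.subset_connectedComponentIn (Set.mem_Iic.2 le_rfl)
        (fun y hy hyF => by
          have : y ∈ F ∩ Set.Iic x := ⟨hyF, hy⟩
          rw [h] at this; exact this)
    exact not_bddBelow_Iic x ((hb.subset hs).bddBelow)
  have hB : (F ∩ Set.Ici x).Nonempty := by
    by_contra h
    rw [Set.not_nonempty_iff_eq_empty] at h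
    have hs : Set.Ici x ⊆ connectedComponentIn Fᶜ x :=
      isPreconnected_Ici.subset_connectedComponentIn (Set.mem_Ici.2 le_rfl)
        (fun y hy hyF => by
          have : y ∈ F ∩ Set.Ici x := ⟨hyF, hy⟩
          rw [h] at this; exact this)
    exact not_bddAbove_Ici x ((hb.subset hs).bddAbove)
  have hAb : BddAbove (F ∩ Set.Iic x) := ⟨x, fun y hy => hy.2⟩
  have hBb : BddBelow (F ∩ Set.Ici x) := ⟨x, fun y hy => hy.2⟩
  have hl := (hcl.inter isClosed_Iic).csSup_mem hA hAb
  have hr := (hcl.inter isClosed_Ici).csInf_mem hB hBb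
  have hlx : sSup (F ∩ Set.Iic x) < x := lt_of_le_of_ne hl.2 (fun h => hx (h ▸ hl.1))
  have hxr : x < sInf (F ∩ Set.Ici x) := lt_of_le_of_ne hr.2 (fun h => hx (h.symm ▸ hr.1))
  have hd : ∀ y ∈ F, ¬ (sSup (F ∩ Set.Iic x) < y ∧ y < sInf (F ∩ Set.Ici x)) := by
    rintro y hy ⟨h1, h2⟩
    rcases le_total y x with h | h
    · exact absurd (le_csSup hAb ⟨hy, h⟩) (not_le.2 h1)
    · exact absurd (csInf_le hBb ⟨hy, h⟩) (not_le.2 h2)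
  exact ⟨_, _, hlx.trans hxr, hl.1, hr.1, hd, gap_of_Ioo hl.1 hr.1 hd ⟨hlx, hxr⟩⟩

/-- Prefix sums of length `n`. -/
def Wset (D : Set ℝ) (q : ℝ) : ℕ → Set ℝ
  | 0 => {0}
  | n + 1 => ⋃ w ∈ Wset D q n, (fun d => w + q ^ n * d) '' D

lemma Wset_finite {D : Set ℝ} (hD : D.Finite) (q : ℝ) (n : ℕ) : (Wset D q n).Finite := by
  induction n with
  | zero => exact Set.finite_singleton _
  | succ n ih => exact ih.biUnion (fun w _ => hD.image _)

lemma Wset_exists {D F : Set ℝ} {q : ℝ}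
    (hself : ∀ x, x ∈ F ↔ ∃ d ∈ D, ∃ y ∈ F, x = d + q * y) (n : ℕ) {x : ℝ} (hx : x ∈ F) :
    ∃ w ∈ Wset D q n, ∃ y ∈ F, x = w + q ^ n * y := by
  induction n with
  | zero => exact ⟨0, rfl, x, hx, by simp⟩
  | succ n ih =>
    obtain ⟨w, hw, y, hy, rfl⟩ := ih
    obtain ⟨d, hd, z, hz, rfl⟩ := (hself y).1 hy
    refine ⟨w + q ^ n * d, ?_, z, hz, by ring⟩
    simp only [Wset, Set.mem_iUnion]
    exact ⟨w, hw, d, hd, rfl⟩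

lemma Wset_mem {D F : Set ℝ} {q : ℝ}
    (hself : ∀ x, x ∈ F ↔ ∃ d ∈ D, ∃ y ∈ F, x = d + q * y) (n : ℕ) {w y : ℝ}
    (hw : w ∈ Wset D q n) (hy : y ∈ F) : w + q ^ n * y ∈ F := by
  induction n generalizing w y with
  | zero =>
    have : w = 0 := hw
    simpa [this] using hy
  | succ n ih =>
    simp only [Wset, Set.mem_iUnion] at hw
    obtain ⟨w', hw', d, hd, rfl⟩ := hw
    have := ih hw' ((hself (d + q * y)).2 ⟨d, hd, y, hy, rfl⟩)
    convert this using 1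
    ring

/-- The gaps accumulating at `-1`. -/
lemma left_gaps {D F : Set ℝ} {q g : ℝ} (hq0 : 0 < q) (hq1 : q < 1)
    (hg : 2 * q < g) (hsub : ∀ x ∈ F, -1 ≤ x ∧ x ≤ 1) (h1 : (1 : ℝ) ∈ F) (h1' : (-1 : ℝ) ∈ F)
    (hself : ∀ x, x ∈ F ↔ ∃ d ∈ D, ∃ y ∈ F, x = d + q * y)
    (hd0 : -(1 - q) ∈ D) (hd1 : -(1 - q) + g ∈ D)
    (hdle : ∀ d ∈ D, d = -(1 - q) ∨ -(1 - q) + g ≤ d) (m : ℕ) :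
    (-1 + 2 * q ^ (m + 1) ∈ F) ∧ (-1 + g * q ^ m ∈ F) ∧
      ∀ y ∈ F, ¬ (-1 + 2 * q ^ (m + 1) < y ∧ y < -1 + g * q ^ m) := by
  have hg0 : 0 < g := by linarith
  induction m with
  | zero =>
    refine ⟨(hself _).2 ⟨_, hd0, 1, h1, by ring⟩, (hself _).2 ⟨_, hd1, -1, h1', by ring⟩, ?_⟩
    rintro y hy ⟨ha, hb⟩
    obtain ⟨d, hd, z, hz, rfl⟩ := (hself y).1 hy
    have := hsub z hz
    simp only [zero_add, pow_one, pow_zero, mul_one] at ha hb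
    rcases hdle d hd with rfl | h
    · nlinarith
    · nlinarith
  | succ m ih =>
    obtain ⟨i1, i2, i3⟩ := ih
    refine ⟨(hself _).2 ⟨_, hd0, _, i1, by ring⟩, (hself _).2 ⟨_, hd0, _, i2, by ring⟩, ?_⟩
    rintro y hy ⟨ha, hb⟩
    obtain ⟨d, hd, z, hz, rfl⟩ := (hself y).1 hy
    have hz' := hsub z hz
    rcases hdle d hd with rfl | h
    · refine i3 z hz ⟨?_, ?_⟩
      · have : q * (-1 + 2 * q ^ (m + 1)) < q * z := by
          have e : q * (-1 + 2 * q ^ (m + 1)) = -q + 2 * q ^ (m + 1 + 1) := by ring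
          linarith
        exact lt_of_mul_lt_mul_left this hq0.le
      · have : q * z < q * (-1 + g * q ^ m) := by
          have e : q * (-1 + g * q ^ m) = -q + g * q ^ (m + 1) := by ring
          linarith
        exact lt_of_mul_lt_mul_left this hq0.le
    · have hp : q ^ (m + 1) ≤ 1 := pow_le_one₀ hq0.le hq1.le
      have : g * q ^ (m + 1) ≤ g := by nlinarith
      nlinarith

lemma right_end {D F : Set ℝ} {q g : ℝ} (hq0 : 0 < q) (hq1 : q < 1)
    (hg : 2 * q < g) (hsub : ∀ x ∈ F, -1 ≤ x ∧ x ≤ 1) (h1 : (1 : ℝ) ∈ F) (h1' : (-1 : ℝ) ∈ F)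
    (hD : D.Finite)
    (hself : ∀ x, x ∈ F ↔ ∃ d ∈ D, ∃ y ∈ F, x = d + q * y)
    (hd0 : -(1 - q) ∈ D) (hd1 : -(1 - q) + g ∈ D)
    (hdle : ∀ d ∈ D, d = -(1 - q) ∨ -(1 - q) + g ≤ d)
    (hK : ∃ c d, c < d ∧ Set.Icc c d ⊆ F)
    {u p : ℝ} (hup : u < p) (hp : p ∈ F) (hgap : ∀ y ∈ F, ¬ (u < y ∧ y < p))
    {ε : ℝ} (hε : 0 < ε) :
    (∃ l r, p < l ∧ l < r ∧ r < p + ε ∧ l ∈ F ∧ r ∈ F ∧ ∀ y ∈ F, ¬ (l < y ∧ y < r)) ∧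
    (∃ c d, p < c ∧ c < d ∧ d < p + ε ∧ Set.Icc c d ⊆ F) := by
  have hg0 : 0 < g := by linarith
  obtain ⟨n, hn⟩ : ∃ n : ℕ, q ^ n < (p - u) / 2 :=
    exists_pow_lt_of_lt_one (by linarith) hq1
  have hqn : 0 < q ^ n := pow_pos hq0 n
  -- the prefix of `p`
  have hw : ∃ w ∈ Wset D q n, p = w - q ^ n := by
    obtain ⟨w, hw, y, hy, hpw⟩ := Wset_exists hself n hp
    refine ⟨w, hw, ?_⟩
    have hm := Wset_mem hself n hw h1'
    have hy' := hsub y hy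
    have := hgap _ hm
    push Not at this
    have h2 : u < w + q ^ n * -1 := by nlinarith
    have h3 := this h2
    nlinarith
  obtain ⟨w, hw, hpw⟩ := hw
  have hpF : ∀ N, n ≤ N → ∀ y ∈ F, p + q ^ N * (y + 1) ∈ F := by
    intro N hN
    induction N, hN using Nat.le_induction with
    | base =>
      intro y hy
      have := Wset_mem hself n hw hy
      convert this using 1
      rw [hpw]; ring
    | succ N hN ih =>
      intro y hy
      have := ih _ ((hself _).2 ⟨_, hd0, y, hy, rfl⟩)
      convert this using 1
      ring
  obtain ⟨δ, hδ0, hδ⟩ : ∃ δ > 0, ∀ v ∈ Wset D q n, p < v - q ^ n → p + δ ≤ v - q ^ n := by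
    have hev : ∀ᶠ δ in nhdsWithin (0 : ℝ) (Set.Ioi 0),
        ∀ v ∈ Wset D q n, p < v - q ^ n → p + δ ≤ v - q ^ n := by
      rw [Filter.eventually_all_finite (Wset_finite hD q n)]
      intro v _
      by_cases hv : p < v - q ^ n
      · have : Set.Ioo 0 (v - q ^ n - p) ∈ nhdsWithin (0 : ℝ) (Set.Ioi 0) :=
          Ioo_mem_nhdsGT (by linarith)
        filter_upwards [this] with δ hδ _
        linarith [hδ.2]
      · exact Filter.Eventually.of_forall (fun δ h => absurd h hv)
    obtain ⟨δ, h, hpos⟩ := (hev.and self_mem_nhdsWithin).exists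
    exact ⟨δ, hpos, h⟩
  have key : ∀ x ∈ F, p < x → x < p + δ → ∃ y ∈ F, x = p + q ^ n * (y + 1) := by
    intro x hx hpx hxd
    obtain ⟨v, hv, y, hy, rfl⟩ := Wset_exists hself n hx
    have hy' := hsub y hy
    refine ⟨y, hy, ?_⟩
    have hm := Wset_mem hself n hv h1'
    rcases lt_trichotomy (v - q ^ n) p with h | h | h
    · exfalso
      have := hgap _ hm
      push Not at this
      have h3 : v + q ^ n * -1 ≤ u := by
        by_contra hc
        push Not at hc
        linarith [this hc]
      nlinarith
    · rw [← h]; ring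
    · exfalso
      have := hδ v hv h
      nlinarith
  constructor
  · obtain ⟨M, hM⟩ : ∃ M : ℕ, q ^ M < min δ ε / g :=
      exists_pow_lt_of_lt_one (by positivity) hq1
    rw [lt_div_iff₀ hg0] at hM
    have hle : q ^ (n + M) ≤ q ^ M := pow_le_pow_of_le_one hq0.le hq1.le (by omega)
    have hpos : 0 < q ^ (n + M) := pow_pos hq0 _
    have hr : g * q ^ (n + M) < min δ ε := by nlinarith
    have hr1 := lt_of_lt_of_le hr (min_le_left _ _)
    have hr2 := lt_of_lt_of_le hr (min_le_right _ _)
    obtain ⟨g1, g2, g3⟩ := left_gaps hq0 hq1 hg hsub h1 h1' hself hd0 hd1 hdle M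
    refine ⟨p + 2 * q ^ (n + M + 1), p + g * q ^ (n + M), ?_, ?_, ?_, ?_, ?_, ?_⟩
    · have := pow_pos hq0 (n + M + 1)
      linarith
    · rw [pow_succ]; nlinarith
    · linarith
    · have := hpF n le_rfl _ g1
      convert this using 1
      ring
    · have := hpF n le_rfl _ g2
      convert this using 1
      ring
    · rintro x hx ⟨ha, hb⟩
      have h0 := pow_pos hq0 (n + M + 1)
      obtain ⟨y, hy, rfl⟩ := key x hx (by linarith) (by linarith)
      refine g3 y hy ⟨?_, ?_⟩
      · have : q ^ n * (2 * q ^ (M + 1)) < q ^ n * (y + 1) := by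
          have e : q ^ n * (2 * q ^ (M + 1)) = 2 * q ^ (n + M + 1) := by ring
          linarith
        linarith [lt_of_mul_lt_mul_left this hqn.le]
      · have : q ^ n * (y + 1) < q ^ n * (g * q ^ M) := by
          have e : q ^ n * (g * q ^ M) = g * q ^ (n + M) := by ring
          linarith
        linarith [lt_of_mul_lt_mul_left this hqn.le]
  · obtain ⟨c, d, hcd, hsubK⟩ := hK
    have hc := hsub c (hsubK ⟨le_rfl, hcd.le⟩)
    have hdd := hsub d (hsubK ⟨hcd.le, le_rfl⟩)
    obtain ⟨M, hM⟩ : ∃ M : ℕ, q ^ M < ε / 2 :=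
      exists_pow_lt_of_lt_one (by positivity) hq1
    have hle : q ^ (n + M) ≤ q ^ M := pow_le_pow_of_le_one hq0.le hq1.le (by omega)
    have hpos : 0 < q ^ (n + M) := pow_pos hq0 _
    refine ⟨p + q ^ (n + M) * ((c + d) / 2 + 1), p + q ^ (n + M) * (d + 1), ?_, ?_, ?_, ?_⟩
    · nlinarith
    · nlinarith
    · nlinarith
    · intro x hx
      have hy : (x - p) / q ^ (n + M) - 1 ∈ F := by
        apply hsubK
        have e1 : (c + d) / 2 + 1 ≤ (x - p) / q ^ (n + M) := by
          rw [le_div_iff₀ hpos]; linarith [hx.1]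
        have e2 : (x - p) / q ^ (n + M) ≤ d + 1 := by
          rw [div_le_iff₀ hpos]; linarith [hx.2]
        constructor <;> linarith
      have := hpF (n + M) (by omega) _ hy
      convert this using 1
      field_simp
      ring

/-- From local data near `p` to gaps and components. -/
lemma comp_of {F : Set ℝ} {l₀ l₁ r₀ r₁ c d : ℝ}
    (hg0 : ∀ y ∈ F, ¬ (l₀ < y ∧ y < r₀)) (hg1 : ∀ y ∈ F, ¬ (l₁ < y ∧ y < r₁))
    (h0 : l₀ < r₀) (h1 : l₁ < r₁) (hc : r₀ ≤ c) (hcd : c < d) (hd : d ≤ l₁)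
    (hcdF : Set.Icc c d ⊆ F) :
    ∃ C, IsProperComponentOf F C ∧ C ⊆ Set.Icc r₀ l₁ := by
  have hcF : c ∈ F := hcdF ⟨le_rfl, hcd.le⟩
  have hsub : Set.Icc c d ⊆ connectedComponentIn F c :=
    isPreconnected_Icc.subset_connectedComponentIn ⟨le_rfl, hcd.le⟩ hcdF
  have hoc : (connectedComponentIn F c).OrdConnected :=
    isPreconnected_connectedComponentIn.ordConnected
  have hcm := mem_connectedComponentIn hcF
  refine ⟨connectedComponentIn F c, ⟨⟨c, hcF, rfl⟩,
    c, hsub ⟨le_rfl, hcd.le⟩, d, hsub ⟨hcd.le, le_rfl⟩, hcd.ne⟩, ?_⟩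
  intro z hz
  constructor
  · by_contra h
    push Not at h
    have hm : max z ((l₀ + r₀) / 2) ∈ connectedComponentIn F c :=
      hoc.out hz hcm ⟨le_max_left _ _, max_le (by linarith) (by linarith)⟩
    exact hg0 _ (connectedComponentIn_subset _ _ hm)
      ⟨lt_of_lt_of_le (by linarith) (le_max_right _ _), max_lt h (by linarith)⟩
  · by_contra h
    push Not at h
    have hm : min z ((l₁ + r₁) / 2) ∈ connectedComponentIn F c :=
      hoc.out hcm hz ⟨le_min (by linarith) (by linarith), min_le_left _ _⟩
    exact hg1 _ (connectedComponentIn_subset _ _ hm)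
      ⟨lt_min h (by linarith), lt_of_le_of_lt (min_le_right _ _) (by linarith)⟩

lemma abstract_cantorval {D F : Set ℝ} {q g : ℝ} (hq0 : 0 < q) (hq1 : q < 1)
    (hg : 2 * q < g) (hcl : IsClosed F)
    (hsub : ∀ x ∈ F, -1 ≤ x ∧ x ≤ 1) (hneg : ∀ x ∈ F, -x ∈ F) (h1 : (1 : ℝ) ∈ F)
    (hD : D.Finite)
    (hself : ∀ x, x ∈ F ↔ ∃ d ∈ D, ∃ y ∈ F, x = d + q * y)
    (hd0 : -(1 - q) ∈ D) (hd1 : -(1 - q) + g ∈ D)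
    (hdle : ∀ d ∈ D, d = -(1 - q) ∨ -(1 - q) + g ≤ d)
    (hK : ∃ c d, c < d ∧ Set.Icc c d ⊆ F) : IsCantorval F := by
  have h1' : (-1 : ℝ) ∈ F := hneg 1 h1
  have hg0 : 0 < g := by linarith
  refine ⟨⟨hcl, ?_⟩, ?_, ?_⟩
  · intro x hx
    rw [accPt_iff_nhds]
    intro U hU
    obtain ⟨ε, hε, hb⟩ := Metric.mem_nhds_iff.1 hU
    obtain ⟨n, hn⟩ : ∃ n : ℕ, q ^ n < ε / 2 := exists_pow_lt_of_lt_one (by linarith) hq1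
    have hqn : 0 < q ^ n := pow_pos hq0 n
    obtain ⟨w, hw, y, hy, rfl⟩ := Wset_exists hself n hx
    have hy' := hsub y hy
    have ma := Wset_mem hself n hw h1
    have mb := Wset_mem hself n hw h1'
    by_cases hy1 : y = 1
    · refine ⟨w + q ^ n * -1, ⟨hb ?_, mb⟩, ?_⟩
      · rw [Metric.mem_ball, Real.dist_eq, abs_lt]
        subst hy1
        constructor <;> nlinarith
      · subst hy1
        intro h; linarith
    · refine ⟨w + q ^ n * 1, ⟨hb ?_, ma⟩, ?_⟩
      · rw [Metric.mem_ball, Real.dist_eq, abs_lt]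
        constructor <;> nlinarith
      · intro h
        apply hy1
        have h' : q ^ n * 1 = q ^ n * y := by linarith
        exact (mul_left_cancel₀ hqn.ne' h').symm
  · have hlt : ∀ m : ℕ, -1 + 2 * q ^ (m + 1) < -1 + g * q ^ m := by
      intro m
      have := pow_pos hq0 m
      rw [pow_succ]; nlinarith
    refine Set.infinite_of_injective_forall_mem
      (f := fun m : ℕ => Set.Ioo (-1 + 2 * q ^ (m + 1)) (-1 + g * q ^ m)) ?_ ?_
    · intro m m' h
      have h' := congrArg sInf h
      simp only [csInf_Ioo (hlt m), csInf_Ioo (hlt m')] at h'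
      have h2 : q ^ (m + 1) = q ^ (m' + 1) := by linarith
      have := (pow_right_strictAnti₀ hq0 hq1).injective h2
      omega
    · intro m
      obtain ⟨i1, i2, i3⟩ := left_gaps hq0 hq1 hg hsub h1 h1' hself hd0 hd1 hdle m
      exact isGap_of_Ioo (hlt m) i1 i2 i3
  · intro G hG p hp
    obtain ⟨l, r, hlr, hl, hr, hd, rfl⟩ := Ioo_of_isGap hcl hG
    rw [csInf_Ioo hlr, csSup_Ioo hlr] at hp
    rcases hp with rfl | rfl
    · -- left endpoint: reflect
      have hd' : ∀ y ∈ F, ¬ (-r < y ∧ y < -p) := fun y hy h =>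
        hd (-y) (hneg y hy) ⟨by linarith [h.2], by linarith [h.1]⟩
      have R := fun ε (hε : (0 : ℝ) < ε) => right_end hq0 hq1 hg hsub h1 h1' hD hself hd0 hd1 hdle hK
        (u := -r) (p := -p) (by linarith) (hneg p hl) hd' hε
      have R1 : ∀ ε > 0, ∃ l' r', p - ε < l' ∧ l' < r' ∧ r' < p ∧ l' ∈ F ∧ r' ∈ F ∧
          ∀ y ∈ F, ¬ (l' < y ∧ y < r') := by
        intro ε hε
        obtain ⟨l', r', e1, e2, e3, e4, e5, e6⟩ := (R ε hε).1
        exact ⟨-r', -l', by linarith, by linarith, by linarith, hneg _ e5, hneg _ e4,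
          fun y hy h => e6 (-y) (hneg y hy) ⟨by linarith [h.2], by linarith [h.1]⟩⟩
      constructor
      · intro ε hε
        obtain ⟨l', r', e1, e2, e3, e4, e5, e6⟩ := R1 ε hε
        refine ⟨_, isGap_of_Ioo e2 e4 e5 e6, ?_, ?_⟩
        · intro h
          have h' := congrArg sInf h
          rw [csInf_Ioo hlr, csInf_Ioo e2] at h'
          linarith
        · exact Set.Ioo_subset_Ioo (by linarith) (by linarith)
      · intro ε hε
        obtain ⟨l', r', e1, e2, e3, e4, e5, e6⟩ := R1 ε hε
        obtain ⟨c, d, f1, f2, f3, f4⟩ := (R (p - r') (by linarith)).2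
        obtain ⟨C, hC, hCs⟩ := comp_of (F := F) (c := -d) (d := -c) e6 hd e2 hlr (by linarith)
          (by linarith) (by linarith) (fun y hy => by
            have := hneg _ (f4 (show -y ∈ Set.Icc c d from ⟨by linarith [hy.2], by linarith [hy.1]⟩))
            simpa using this)
        refine ⟨C, hC, fun z hz => ?_⟩
        have := hCs hz
        exact ⟨by linarith [this.1], by linarith [this.2]⟩
    · have R := fun ε (hε : (0 : ℝ) < ε) => right_end hq0 hq1 hg hsub h1 h1' hD hself hd0 hd1 hdle hK
        hlr hr hd hε
      constructor
      · intro ε hε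
        obtain ⟨l', r', e1, e2, e3, e4, e5, e6⟩ := (R ε hε).1
        refine ⟨_, isGap_of_Ioo e2 e4 e5 e6, ?_, ?_⟩
        · intro h
          have h' := congrArg sInf h
          rw [csInf_Ioo hlr, csInf_Ioo e2] at h'
          linarith
        · exact Set.Ioo_subset_Ioo (by linarith) (by linarith)
      · intro ε hε
        obtain ⟨l', r', e1, e2, e3, e4, e5, e6⟩ := (R ε hε).1
        obtain ⟨c, d, f1, f2, f3, f4⟩ := (R (l' - p) (by linarith)).2
        obtain ⟨C, hC, hCs⟩ := comp_of (F := F) (c := c) (d := d) hd e6 hlr e2 (by linarith)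
          (by linarith) (by linarith) f4
        refine ⟨C, hC, fun z hz => ?_⟩
        have := hCs hz
        exact ⟨by linarith [this.1], by linarith [this.2]⟩

/-- An interval contained in a self-similar set. -/
lemma interval_sub {D F : Set ℝ} {q κ : ℝ} (hq0 : 0 < q) (hq1 : q < 1) (hκ : 0 < κ)
    (hcl : IsClosed F) (h0 : (0 : ℝ) ∈ F)
    (hself : ∀ x, x ∈ F ↔ ∃ d ∈ D, ∃ y ∈ F, x = d + q * y)
    (hcov : ∀ y, -κ ≤ y → y ≤ κ → ∃ d ∈ D, |y - d| ≤ q * κ) :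
    Set.Icc (-κ) κ ⊆ F := by
  have key : ∀ n : ℕ, ∀ y, -κ ≤ y → y ≤ κ → ∃ f ∈ F, |y - f| ≤ q ^ n * κ := by
    intro n
    induction n with
    | zero => exact fun y ha hb => ⟨0, h0, by simp [abs_le]; exact ⟨ha, hb⟩⟩
    | succ n ih =>
      intro y ha hb
      obtain ⟨d, hd, hyd⟩ := hcov y ha hb
      rw [abs_le] at hyd
      obtain ⟨f, hf, hyf⟩ := ih ((y - d) / q) (by rw [le_div_iff₀ hq0]; linarith)
        (by rw [div_le_iff₀ hq0]; linarith)
      refine ⟨d + q * f, (hself _).2 ⟨d, hd, f, hf, rfl⟩, ?_⟩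
      have e : y - (d + q * f) = q * ((y - d) / q - f) := by field_simp; ring
      rw [e, abs_mul, abs_of_pos hq0, pow_succ]
      nlinarith
  intro y hy
  rw [← hcl.closure_eq, Metric.mem_closure_iff]
  intro ε hε
  obtain ⟨n, hn⟩ : ∃ n : ℕ, q ^ n < ε / κ := exists_pow_lt_of_lt_one (by positivity) hq1
  rw [lt_div_iff₀ hκ] at hn
  obtain ⟨f, hf, h⟩ := key n y hy.1 hy.2
  exact ⟨f, hf, by rw [Real.dist_eq]; linarith⟩

section periodic

variable {a : ℕ → ℝ}

lemma dSeq_zero : dSeq a 0 = 1 := by simp [dSeq]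

lemma dSeq_succ (n : ℕ) : dSeq a (n + 1) = dSeq a n * ((1 - a (n + 1)) / 2) := by
  unfold dSeq
  rw [Finset.prod_Icc_succ_top (by omega)]

lemma dSeq_add_two (hper : ∀ n, a (n + 2) = a n ∨ n = 0) (n : ℕ) :
    dSeq a (n + 2) = dSeq a 2 * dSeq a n := by
  induction n with
  | zero => simp [dSeq_zero]
  | succ n ih =>
    have h : a (n + 1 + 2) = a (n + 1) := (hper (n + 1)).resolve_right (by omega)
    rw [show n + 1 + 2 = (n + 2) + 1 by ring, dSeq_succ (n + 2), ih, dSeq_succ n,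
      show n + 2 + 1 = n + 1 + 2 by ring, h]
    ring

lemma Il_cons_cons (hper : ∀ n, a (n + 2) = a n ∨ n = 0) (i j : ℕ) (t : List ℕ) :
    Il a (i :: j :: t) = i * (dSeq a 0 - dSeq a 1) + j * (dSeq a 1 - dSeq a 2)
      + dSeq a 2 * Il a t := by
  unfold Il
  rw [List.length_cons, List.length_cons, Finset.sum_range_succ', Finset.sum_range_succ',
    Finset.mul_sum]
  have : ∀ k, dSeq a (k + 1 + 1) - dSeq a (k + 1 + 1 + 1) = dSeq a 2 * (dSeq a k - dSeq a (k + 1)) := by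
    intro k
    have e1 := dSeq_add_two hper k
    have e2 := dSeq_add_two hper (k + 1)
    rw [show k + 1 + 1 = k + 2 by ring, show k + 2 + 1 = k + 1 + 2 by ring, e1, e2]
    ring
  simp only [List.getD_cons_succ, List.getD_cons_zero, this, zero_add]
  have e : ∑ x ∈ Finset.range t.length, (t.getD x 0 : ℝ) * (dSeq a 2 * (dSeq a x - dSeq a (x + 1)))
      = ∑ x ∈ Finset.range t.length, dSeq a 2 * ((t.getD x 0 : ℝ) * (dSeq a x - dSeq a (x + 1))) :=
    Finset.sum_congr rfl (fun x _ => by ring)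
  rw [e]
  norm_num
  ring

lemma mem_step {n : ℕ} {x : ℝ} : x ∈ cantorStep a n ↔
    ∃ t : List ℕ, t.length = n ∧ (∀ j ∈ t, j ≤ 1) ∧ Il a t ≤ x ∧ x ≤ Il a t + dSeq a n := by
  simp only [cantorStep, Set.mem_iUnion, Set.mem_ofPred_eq, Set.mem_Icc, exists_prop, and_assoc]

lemma mem_step_add_two (hper : ∀ n, a (n + 2) = a n ∨ n = 0) (hq : 0 < dSeq a 2) {n : ℕ} {x : ℝ} :
    x ∈ cantorStep a (n + 2) ↔ ∃ i j : ℕ, i ≤ 1 ∧ j ≤ 1 ∧ ∃ y ∈ cantorStep a n,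
      x = i * (dSeq a 0 - dSeq a 1) + j * (dSeq a 1 - dSeq a 2) + dSeq a 2 * y := by
  rw [mem_step]
  constructor
  · rintro ⟨t, ht, htj, hx1, hx2⟩
    match t, ht with
    | i :: j :: t, ht =>
      simp only [List.length_cons] at ht
      simp only [List.mem_cons, forall_eq_or_imp] at htj
      rw [Il_cons_cons hper] at hx1 hx2
      rw [dSeq_add_two hper n] at hx2
      refine ⟨i, j, htj.1, htj.2.1,
        (x - (i * (dSeq a 0 - dSeq a 1) + j * (dSeq a 1 - dSeq a 2))) / dSeq a 2, ?_, ?_⟩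
      · rw [mem_step]
        refine ⟨t, by omega, htj.2.2, ?_, ?_⟩
        · rw [le_div_iff₀ hq]; linarith
        · rw [div_le_iff₀ hq]; linarith
      · field_simp
        ring
  · rintro ⟨i, j, hi, hj, y, hy, rfl⟩
    rw [mem_step] at hy
    obtain ⟨t, ht, htj, h1, h2⟩ := hy
    refine ⟨i :: j :: t, by simp [ht], by simpa [hi, hj] using htj, ?_, ?_⟩
    · rw [Il_cons_cons hper]; nlinarith
    · rw [Il_cons_cons hper, dSeq_add_two hper n]; nlinarith

lemma step_anti (ha : ∀ n, 0 < a n ∧ a n < 1) (n : ℕ) : cantorStep a (n + 1) ⊆ cantorStep a n := by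
  have hpos : ∀ n, 0 < dSeq a n := fun n =>
    Finset.prod_pos (fun i _ => by linarith [(ha i).2])
  intro x hx
  rw [mem_step] at hx ⊢
  obtain ⟨t, ht, htj, h1, h2⟩ := hx
  have hne : t ≠ [] := by rintro rfl; simp at ht
  obtain ⟨s, k, rfl⟩ : ∃ s k, t = s ++ [k] := ⟨_, _, (List.dropLast_append_getLast hne).symm⟩
  have hs : s.length = n := by simpa using ht
  have hk : k ≤ 1 := htj k (by simp)
  have e : Il a (s ++ [k]) = Il a s + k * (dSeq a n - dSeq a (n + 1)) := by
    unfold Il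
    rw [List.length_append, List.length_singleton, Finset.sum_range_succ, hs]
    congr 1
    · apply Finset.sum_congr rfl
      intro i hi
      rw [List.getD_append _ _ _ _ (by rw [hs]; exact Finset.mem_range.1 hi)]
    · rw [List.getD_append_right _ _ _ _ hs.le, hs]
      simp
  rw [e] at h1 h2
  have hk' : (k : ℝ) ≤ 1 := by exact_mod_cast hk
  have hk0 : (0 : ℝ) ≤ k := k.cast_nonneg
  have hd : dSeq a (n + 1) ≤ dSeq a n := by
    rw [dSeq_succ]
    have := ha (n + 1)
    have := hpos n
    nlinarith
  refine ⟨s, hs, fun j hj => htj j (by simp [hj]), ?_, ?_⟩ <;> nlinarith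

lemma step_antitone (ha : ∀ n, 0 < a n ∧ a n < 1) : Antitone (cantorStep a) :=
  antitone_nat_of_succ_le (step_anti ha)

lemma step_zero : cantorStep a 0 = Set.Icc 0 1 := by
  ext x
  rw [mem_step]
  constructor
  · rintro ⟨t, ht, -, h1, h2⟩
    obtain rfl := List.length_eq_zero_iff.1 ht
    simp [Il, dSeq_zero] at h1 h2
    exact ⟨h1, h2⟩
  · rintro ⟨h1, h2⟩
    exact ⟨[], rfl, by simp, by simpa [Il] using h1, by simpa [Il, dSeq_zero] using h2⟩

lemma cantor_self (ha : ∀ n, 0 < a n ∧ a n < 1) (hper : ∀ n, a (n + 2) = a n ∨ n = 0)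
    (hq : 0 < dSeq a 2) {x : ℝ} :
    x ∈ cantorSet a ↔ ∃ i j : ℕ, i ≤ 1 ∧ j ≤ 1 ∧ ∃ y ∈ cantorSet a,
      x = i * (dSeq a 0 - dSeq a 1) + j * (dSeq a 1 - dSeq a 2) + dSeq a 2 * y := by
  constructor
  · intro hx
    have hx' : ∀ n, x ∈ cantorStep a n := fun n => Set.mem_iInter.1 hx n
    have hf : ∀ n, ∃ p : Fin 2 × Fin 2, ∃ y ∈ cantorStep a n,
      x = (p.1 : ℕ) * (dSeq a 0 - dSeq a 1) + (p.2 : ℕ) * (dSeq a 1 - dSeq a 2) + dSeq a 2 * y := by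
      intro n
      obtain ⟨i, j, hi, hj, y, hy, h⟩ := (mem_step_add_two hper hq).1 (hx' (n + 2))
      exact ⟨(⟨i, by omega⟩, ⟨j, by omega⟩), y, hy, h⟩
    choose f hf using hf
    obtain ⟨p, hp⟩ := Finite.exists_infinite_fiber f
    have hinf : (f ⁻¹' {p}).Infinite := Set.infinite_coe_iff.1 hp
    refine ⟨p.1, p.2, by omega, by omega,
      (x - ((p.1 : ℕ) * (dSeq a 0 - dSeq a 1) + (p.2 : ℕ) * (dSeq a 1 - dSeq a 2))) / dSeq a 2, ?_, ?_⟩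
    · refine Set.mem_iInter.2 (fun n => ?_)
      obtain ⟨m, hm, hnm⟩ := hinf.exists_gt n
      obtain ⟨y, hy, h⟩ := hf m
      have hm' : f m = p := hm
      rw [hm'] at h
      apply step_antitone ha hnm.le
      convert hy using 1
      rw [h]
      field_simp
      ring
    · field_simp
      ring
  · rintro ⟨i, j, hi, hj, y, hy, h⟩
    refine Set.mem_iInter.2 (fun n => step_antitone ha (show n ≤ n + 2 by omega) ?_)
    exact (mem_step_add_two hper hq).2 ⟨i, j, hi, hj, y, Set.mem_iInter.1 hy n, h⟩

lemma step_even_compact (hper : ∀ n, a (n + 2) = a n ∨ n = 0)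
    (hq : 0 < dSeq a 2) (n : ℕ) : IsCompact (cantorStep a (2 * n)) := by
  induction n with
  | zero => rw [mul_zero, step_zero]; exact isCompact_Icc
  | succ n ih =>
    have : cantorStep a (2 * (n + 1)) = ⋃ p : Fin 2 × Fin 2,
        (fun y => ((p.1 : ℕ) : ℝ) * (dSeq a 0 - dSeq a 1) + ((p.2 : ℕ) : ℝ) * (dSeq a 1 - dSeq a 2)
          + dSeq a 2 * y) '' cantorStep a (2 * n) := by
      ext x
      rw [show 2 * (n + 1) = 2 * n + 2 by ring, mem_step_add_two hper hq]
      simp only [Set.mem_iUnion, Set.mem_image]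
      constructor
      · rintro ⟨i, j, hi, hj, y, hy, h⟩
        exact ⟨(⟨i, by omega⟩, ⟨j, by omega⟩), y, hy, h.symm⟩
      · rintro ⟨p, y, hy, h⟩
        exact ⟨p.1, p.2, by omega, by omega, y, hy, h.symm⟩
    rw [this]
    exact isCompact_iUnion (fun p => ih.image (by fun_prop))

lemma cantor_compact (ha : ∀ n, 0 < a n ∧ a n < 1) (hper : ∀ n, a (n + 2) = a n ∨ n = 0)
    (hq : 0 < dSeq a 2) : IsCompact (cantorSet a) := by
  have e : cantorSet a = ⋂ n, cantorStep a (2 * n) := by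
    apply Set.Subset.antisymm
    · exact fun x hx => Set.mem_iInter.2 (fun n => Set.mem_iInter.1 hx _)
    · exact fun x hx => Set.mem_iInter.2
        (fun n => step_antitone ha (show n ≤ 2 * n by omega) (Set.mem_iInter.1 hx n))
  rw [e]
  exact (step_even_compact hper hq 0).of_isClosed_subset
    (isClosed_iInter fun n => (step_even_compact hper hq n).isClosed) (Set.iInter_subset _ 0)

lemma cantor_sub {x : ℝ} (hx : x ∈ cantorSet a) : 0 ≤ x ∧ x ≤ 1 := by
  have := Set.mem_iInter.1 hx 0
  rwa [step_zero] at this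

lemma cantor_zero_one (ha : ∀ n, 0 < a n ∧ a n < 1) (hper : ∀ n, a (n + 2) = a n ∨ n = 0)
    (hq : 0 < dSeq a 2) : (0 : ℝ) ∈ cantorSet a ∧ (1 : ℝ) ∈ cantorSet a := by
  have h : ∀ n, (0 : ℝ) ∈ cantorStep a (2 * n) ∧ (1 : ℝ) ∈ cantorStep a (2 * n) := by
    intro n
    induction n with
    | zero => rw [mul_zero, step_zero]; simp
    | succ n ih =>
      rw [show 2 * (n + 1) = 2 * n + 2 by ring, mem_step_add_two hper hq, mem_step_add_two hper hq]
      exact ⟨⟨0, 0, by omega, by omega, 0, ih.1, by simp⟩,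
        ⟨1, 1, by omega, by omega, 1, ih.2, by simp [dSeq_zero]⟩⟩
  exact ⟨Set.mem_iInter.2 fun n => step_antitone ha (show n ≤ 2 * n by omega) (h n).1,
    Set.mem_iInter.2 fun n => step_antitone ha (show n ≤ 2 * n by omega) (h n).2⟩

end periodic

/-- The centered digit set. -/
def Dig (x₁ x₂ : ℝ) : Set ℝ :=
  (fun p : ℝ × ℝ => p.1 * x₁ + p.2 * x₂) '' (({-1, 0, 1} : Set ℝ) ×ˢ ({-1, 0, 1} : Set ℝ))

lemma Dig_finite (x₁ x₂ : ℝ) : (Dig x₁ x₂).Finite :=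
  Set.Finite.image _ (Set.Finite.prod (by simp) (by simp))

lemma mem_Dig {x₁ x₂ : ℝ} {s t : ℝ} (hs : s = -1 ∨ s = 0 ∨ s = 1) (ht : t = -1 ∨ t = 0 ∨ t = 1)
    {d : ℝ} (h : d = s * x₁ + t * x₂) : d ∈ Dig x₁ x₂ :=
  ⟨(s, t), ⟨by simpa using hs, by simpa using ht⟩, h.symm⟩

lemma of_mem_Dig {x₁ x₂ d : ℝ} (h : d ∈ Dig x₁ x₂) : ∃ s t : ℝ, (s = -1 ∨ s = 0 ∨ s = 1) ∧
    (t = -1 ∨ t = 0 ∨ t = 1) ∧ d = s * x₁ + t * x₂ := by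
  obtain ⟨⟨s, t⟩, ⟨hs, ht⟩, rfl⟩ := h
  exact ⟨s, t, by simpa using hs, by simpa using ht, rfl⟩

lemma diff_digit (i i' : ℕ) (hi : i ≤ 1) (hi' : i' ≤ 1) :
    (i : ℝ) - i' = -1 ∨ (i : ℝ) - i' = 0 ∨ (i : ℝ) - i' = 1 := by
  interval_cases i <;> interval_cases i' <;> norm_num

lemma digit_diff {s : ℝ} (hs : s = -1 ∨ s = 0 ∨ s = 1) :
    ∃ i i' : ℕ, i ≤ 1 ∧ i' ≤ 1 ∧ s = (i : ℝ) - i' := by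
  rcases hs with rfl | rfl | rfl
  · exact ⟨0, 1, by omega, by omega, by norm_num⟩
  · exact ⟨0, 0, by omega, by omega, by norm_num⟩
  · exact ⟨1, 0, by omega, by omega, by norm_num⟩

lemma diff_self {C : Set ℝ} {x₁ x₂ q : ℝ}
    (hC : ∀ x, x ∈ C ↔ ∃ i j : ℕ, i ≤ 1 ∧ j ≤ 1 ∧ ∃ y ∈ C, x = i * x₁ + j * x₂ + q * y) (x : ℝ) :
    x ∈ C - C ↔ ∃ d ∈ Dig x₁ x₂, ∃ y ∈ C - C, x = d + q * y := by
  constructor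
  · intro hx
    obtain ⟨u, hu, v, hv, rfl⟩ := Set.mem_sub.1 hx
    obtain ⟨i, j, hi, hj, y, hy, rfl⟩ := (hC u).1 hu
    obtain ⟨i', j', hi', hj', y', hy', rfl⟩ := (hC v).1 hv
    exact ⟨_, mem_Dig (diff_digit i i' hi hi') (diff_digit j j' hj hj') rfl, y - y',
      Set.sub_mem_sub hy hy', by ring⟩
  · rintro ⟨d, hd, z, hz, rfl⟩
    obtain ⟨y, hy, y', hy', rfl⟩ := Set.mem_sub.1 hz
    obtain ⟨s, t, hs, ht, rfl⟩ := of_mem_Dig hd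
    obtain ⟨i, i', hi, hi', rfl⟩ := digit_diff hs
    obtain ⟨j, j', hj, hj', rfl⟩ := digit_diff ht
    exact Set.mem_sub.2 ⟨_, (hC _).2 ⟨i, j, hi, hj, y, hy, rfl⟩,
      _, (hC _).2 ⟨i', j', hi', hj', y', hy', rfl⟩, by ring⟩

/-- The numerical consequences of the hypotheses, with `w = 1 - a₁`, `v = (1 - a₁) a₂`. -/
lemma numeric {a₁ a₂ : ℝ} (ha₁pos : 0 < a₁) (ha₂ : 1 / 3 < a₂) (h1 : a₁ ≤ 1 / 35)
    (h2 : a₂ ≤ (-a₁ - 5 + Real.sqrt (a₁ ^ 2 + 34 * a₁ + 33)) / (2 - 2 * a₁)) :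
    ((1 - a₁) * a₂) ^ 2 + (5 + a₁) * ((1 - a₁) * a₂) ≤ 2 + 6 * a₁ ∧ (1 - a₁) * a₂ ≤ 2 / 5 := by
  rw [le_div_iff₀ (by linarith)] at h2
  have hv0 : 0 < (1 - a₁) * a₂ := mul_pos (by linarith) (by linarith)
  have hsq := Real.sq_sqrt (show (0 : ℝ) ≤ a₁ ^ 2 + 34 * a₁ + 33 by positivity)
  set S := Real.sqrt (a₁ ^ 2 + 34 * a₁ + 33)
  have h3 : 2 * ((1 - a₁) * a₂) + a₁ + 5 ≤ S := by linarith
  generalize (1 - a₁) * a₂ = v at *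
  have h4 : (2 * v + a₁ + 5) ^ 2 ≤ S ^ 2 := pow_le_pow_left₀ (by linarith) h3 2
  have h5 : v ^ 2 + (5 + a₁) * v ≤ 2 + 6 * a₁ := by nlinarith
  refine ⟨h5, ?_⟩
  by_contra hc
  push Not at hc
  by_cases h6 : v ≤ 6
  · nlinarith [mul_nonneg (sub_nonneg.2 h1) (sub_nonneg.2 h6)]
  · nlinarith

/-- For the 2-periodic sequence `a = (a₁, a₂, a₁, a₂, …)` with `a₁ < 1/3 < a₂`:
if `a₁ ≤ 1/35` and `a₂ ≤ (-a₁ - 5 + √(a₁² + 34a₁ + 33))/(2 - 2a₁)`, then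
`C(a) - C(a)` is a Cantorval. -/
theorem cantorval_of_periodic_small (a₁ a₂ : ℝ) (a : ℕ → ℝ)
    (hadef : a = fun n => if n % 2 = 1 then a₁ else a₂)
    (ha₁pos : 0 < a₁) (ha₁ : a₁ < 1 / 3) (ha₂ : 1 / 3 < a₂) (ha₂lt : a₂ < 1)
    (h1 : a₁ ≤ 1 / 35)
    (h2 : a₂ ≤ (-a₁ - 5 + Real.sqrt (a₁ ^ 2 + 34 * a₁ + 33)) / (2 - 2 * a₁)) :
    IsCantorval (cantorSet a - cantorSet a) := by
  have hd2' : ∀ n, 0 < a n ∧ a n < 1 := by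
    intro n
    rw [hadef]
    dsimp only
    split_ifs <;> constructor <;> linarith
  have hper : ∀ n, a (n + 2) = a n ∨ n = 0 := by
    intro n
    left
    rw [hadef]
    simp
  have hv1 : a 1 = a₁ := by rw [hadef]; simp
  have hv2 : a 2 = a₂ := by rw [hadef]; simp
  have hD1 : dSeq a 1 = (1 - a₁) / 2 := by rw [dSeq_succ, dSeq_zero, hv1]; ring
  have hD2 : dSeq a 2 = (1 - a₁) * (1 - a₂) / 4 := by rw [dSeq_succ, hD1, hv2]; ring
  have hq0 : 0 < dSeq a 2 := by
    rw [hD2]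
    have := mul_pos (show (0 : ℝ) < 1 - a₁ by linarith) (show (0 : ℝ) < 1 - a₂ by linarith)
    linarith
  obtain ⟨n1, n2⟩ := numeric ha₁pos ha₂ h1 h2
  have n3 : (1 - a₁) * (1 / 3) < (1 - a₁) * a₂ := mul_lt_mul_of_pos_left ha₂ (by linarith)
  have hself0 := fun x => cantor_self (x := x) hd2' hper hq0
  have hcomp := cantor_compact hd2' hper hq0
  obtain ⟨z0, z1⟩ := cantor_zero_one hd2' hper hq0
  have hE1 : dSeq a 0 - dSeq a 1 = (1 + a₁) / 2 := by rw [dSeq_zero, hD1]; ring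
  have hE2 : dSeq a 1 - dSeq a 2 = ((1 - a₁) + (1 - a₁) * a₂) / 4 := by rw [hD1, hD2]; ring
  have hE3 : dSeq a 2 = ((1 - a₁) - (1 - a₁) * a₂) / 4 := by rw [hD2]; ring
  simp only [hE1, hE2] at hself0
  generalize dSeq a 2 = q at *
  generalize (1 - a₁) * a₂ = v at *
  set x₁ := (1 + a₁) / 2 with hx₁
  set x₂ := ((1 - a₁) + v) / 4 with hx₂
  have hsum : x₁ + x₂ = 1 - q := by rw [hx₁, hx₂, hE3]; ring
  have hq1 : q < 1 := by rw [hE3]; linarith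
  have hself := diff_self hself0
  have hcl : IsClosed (cantorSet a - cantorSet a) := by
    have e : cantorSet a - cantorSet a =
        (fun p : ℝ × ℝ => p.1 - p.2) '' (cantorSet a ×ˢ cantorSet a) := by
      rw [Set.image_prod]; rfl
    rw [e]
    exact ((hcomp.prod hcomp).image (by fun_prop)).isClosed
  have h0F : (0 : ℝ) ∈ cantorSet a - cantorSet a := Set.mem_sub.2 ⟨0, z0, 0, z0, by ring⟩
  have h1F : (1 : ℝ) ∈ cantorSet a - cantorSet a := Set.mem_sub.2 ⟨1, z1, 0, z0, by ring⟩
  have hx12 : x₂ < x₁ := by rw [hx₁, hx₂]; linarith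
  have hx21 : x₁ ≤ 2 * x₂ := by rw [hx₁, hx₂]; linarith
  have hx1pos : 0 < x₁ := by rw [hx₁]; linarith
  have hx2pos : 0 < x₂ := by linarith
  have hq1' : 0 < 1 - q := by linarith
  have hκe : x₁ / (1 - q) = x₁ + q * (x₁ / (1 - q)) := by field_simp; ring
  have g1 : x₁ - x₂ ≤ 2 * (q * (x₁ / (1 - q))) := by
    rw [show 2 * (q * (x₁ / (1 - q))) = 2 * q * x₁ / (1 - q) by ring, le_div_iff₀ hq1', hx₁, hx₂, hE3]
    have m1 : 0 ≤ (2 / 5 - v) * (2 - 2 / 5 - v) := mul_nonneg (by linarith) (by linarith)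
    nlinarith [mul_nonneg (sub_nonneg.2 n2) ha₁pos.le, mul_nonneg (sub_nonneg.2 h1) ha₁pos.le]
  have g2 : 2 * x₂ - x₁ ≤ 2 * (q * (x₁ / (1 - q))) := by
    rw [show 2 * (q * (x₁ / (1 - q))) = 2 * q * x₁ / (1 - q) by ring, le_div_iff₀ hq1', hx₁, hx₂, hE3]
    nlinarith
  have hκ : 0 < x₁ / (1 - q) := div_pos hx1pos hq1'
  have hK : Set.Icc (-(x₁ / (1 - q))) (x₁ / (1 - q)) ⊆ cantorSet a - cantorSet a := by
    apply interval_sub hq0 hq1 hκ hcl h0F hself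
    generalize x₁ / (1 - q) = κ at *
    intro y ya yb
    have hqk : 0 < q * κ := mul_pos hq0 hκ
    generalize q * κ = e at *
    by_cases c1 : y ≤ -x₁ + e
    · exact ⟨-x₁, mem_Dig (s := -1) (t := 0) (by simp) (by simp) (by ring),
        abs_le.2 ⟨by linarith, by linarith⟩⟩
    by_cases c2 : y ≤ -x₂ + e
    · exact ⟨-x₂, mem_Dig (s := 0) (t := -1) (by simp) (by simp) (by ring),
        abs_le.2 ⟨by linarith, by linarith⟩⟩
    by_cases c3 : y ≤ -x₁ + x₂ + e
    · exact ⟨-x₁ + x₂, mem_Dig (s := -1) (t := 1) (by simp) (by simp) (by ring),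
        abs_le.2 ⟨by linarith, by linarith⟩⟩
    by_cases c4 : y ≤ e
    · exact ⟨0, mem_Dig (s := 0) (t := 0) (by simp) (by simp) (by ring),
        abs_le.2 ⟨by linarith, by linarith⟩⟩
    by_cases c5 : y ≤ x₁ - x₂ + e
    · exact ⟨x₁ - x₂, mem_Dig (s := 1) (t := -1) (by simp) (by simp) (by ring),
        abs_le.2 ⟨by linarith, by linarith⟩⟩
    by_cases c6 : y ≤ x₂ + e
    · exact ⟨x₂, mem_Dig (s := 0) (t := 1) (by simp) (by simp) (by ring),
        abs_le.2 ⟨by linarith, by linarith⟩⟩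
    · exact ⟨x₁, mem_Dig (s := 1) (t := 0) (by simp) (by simp) (by ring),
        abs_le.2 ⟨by linarith, by linarith⟩⟩
  refine abstract_cantorval (D := Dig x₁ x₂) (q := q) (g := x₂) hq0 hq1 ?_ hcl ?_ ?_ h1F
    (Dig_finite _ _) hself ?_ ?_ ?_ ⟨_, _, by linarith, hK⟩
  · rw [hx₂, hE3]; linarith
  · intro x hx
    obtain ⟨u, hu, w, hw, rfl⟩ := Set.mem_sub.1 hx
    have := cantor_sub hu
    have := cantor_sub hw
    constructor <;> linarith
  · intro x hx
    obtain ⟨u, hu, w, hw, rfl⟩ := Set.mem_sub.1 hx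
    exact Set.mem_sub.2 ⟨w, hw, u, hu, by ring⟩
  · exact mem_Dig (s := -1) (t := -1) (by simp) (by simp) (by linarith)
  · exact mem_Dig (s := -1) (t := 0) (by simp) (by simp) (by linarith)
  · intro d hd
    obtain ⟨s, t, hs, ht, rfl⟩ := of_mem_Dig hd
    rcases hs with rfl | rfl | rfl <;> rcases ht with rfl | rfl | rfl
    · left; linarith
    all_goals right; linarith

end CCS
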